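/- Fix ι ∈ {0,1} and let θ : [0,∞) → ℝ ∪ {+∞} be proper, convex, and lower semicontinuous. Then there exists π* ∈ Π_ι such that D_θ(ν_ῑ^{(π*)}‖ν_ῑ) = inf{D_θ(ν_ῑ^{(π)}‖ν_ῑ) : π ∈ Π_ι}; that is, the D_θ-closest one-sided refinement problem on side ι attains its infimum. -/

import Mathlib

/- STATEMENT 6: Attainment of the `D_θ`-closest one-sided refinement problem
(Proposition `vartheta_one_sided_attainment`).  The side `ι ∈ {0,1}` is formalized abstractly:
`X` plays the role of `Ω_ι` and `Y` of `Ω_ῑ`. -/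

open MeasureTheory ProbabilityTheory Filter
open scoped ENNReal NNReal

noncomputable section

/-- The nonnegative part of an extended real number, as an element of `ℝ≥0∞`. -/
def erealToENNReal (a : EReal) : ℝ≥0∞ :=
  if a = ⊤ then ⊤ else ENNReal.ofReal a.toReal

/-- Extended-real integral via positive/negative parts. -/
def erealIntegral {Ω : Type} [MeasurableSpace Ω] (μ : Measure Ω) (f : Ω → EReal) : EReal :=
  ((∫⁻ x, erealToENNReal (f x) ∂μ : ℝ≥0∞) : EReal)
    - ((∫⁻ x, erealToENNReal (-f x) ∂μ : ℝ≥0∞) : EReal)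

/-- Recession slope of `θ`, i.e. `lim_{t → ∞} θ t / t`. -/
def recessionSlope (θ : ℝ → EReal) : EReal :=
  Filter.limsup (fun t : ℝ => θ t * ((t⁻¹ : ℝ) : EReal)) Filter.atTop

/-- The `θ`-divergence `D_θ(P‖Q) = ∫ θ(dP_ac/dQ) dQ + θ'_∞ · P⊥(Ω)`. -/
def thetaDiv {Ω : Type} [MeasurableSpace Ω] (θ : ℝ → EReal) (P Q : Measure Ω) : EReal :=
  erealIntegral Q (fun x => θ ((P.rnDeriv Q x).toReal))
    + recessionSlope θ * ((P.singularPart Q Set.univ : ℝ≥0∞) : EReal)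

/-- `θ : [0,∞) → ℝ ∪ {+∞}` is proper, convex and lower semicontinuous. -/
structure ProperConvexLSCOn (θ : ℝ → EReal) : Prop where
  ne_bot : ∀ x : ℝ, 0 ≤ x → θ x ≠ ⊥
  exists_ne_top : ∃ x : ℝ, 0 ≤ x ∧ θ x ≠ ⊤
  convex : ∀ x y a b : ℝ, 0 ≤ x → 0 ≤ y → 0 ≤ a → 0 ≤ b → a + b = 1 →
    θ (a * x + b * y) ≤ (a : EReal) * θ x + (b : EReal) * θ y
  lsc : LowerSemicontinuousOn θ (Set.Ici 0)

/-- `θ` is strictly convex on its effective domain (within `[0,∞)`). -/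
def StrictlyConvexOnDom (θ : ℝ → EReal) : Prop :=
  ∀ x y a b : ℝ, 0 ≤ x → 0 ≤ y → x ≠ y → θ x ≠ ⊤ → θ y ≠ ⊤ → 0 < a → 0 < b → a + b = 1 →
    θ (a * x + b * y) < (a : EReal) * θ x + (b : EReal) * θ y

variable {X Y : Type} [MeasurableSpace X] [MeasurableSpace Y]

/-- Refinements of `νX` on side `X`: finite plans concentrated on `E` with `X`-marginal `νX`. -/
def Plans (E : Set (X × Y)) (νX : Measure X) : Set (Measure (X × Y)) :=
  {π | IsFiniteMeasure π ∧ π Eᶜ = 0 ∧ π.map Prod.fst = νX}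

/-- Refinements of `νY` on side `Y`. -/
def PlansSnd (E : Set (X × Y)) (νY : Measure Y) : Set (Measure (X × Y)) :=
  {π | IsFiniteMeasure π ∧ π Eᶜ = 0 ∧ π.map Prod.snd = νY}

/-- Capped feasible subplans at level `t`. -/
def Feas (E : Set (X × Y)) (νX : Measure X) (νY : Measure Y) (t : ℝ) :
    Set (Measure (X × Y)) :=
  {σ | IsFiniteMeasure σ ∧ σ Eᶜ = 0 ∧ σ.map Prod.fst ≤ νX ∧
    σ.map Prod.snd ≤ (ENNReal.ofReal t) • νY}

/-- Maximal feasible mass at level `t`. -/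
def Fit (E : Set (X × Y)) (νX : Measure X) (νY : Measure Y) (t : ℝ) : ℝ≥0∞ :=
  ⨆ σ ∈ Feas E νX νY t, σ Set.univ

/-- Level-optimal maximin: at every level `t > 0` the truncated opposite marginal mass
realizes the maximal feasible mass. -/
def LevelOptMaximin (E : Set (X × Y)) (νX : Measure X) (νY : Measure Y)
    (π : Measure (X × Y)) : Prop :=
  ∀ t : ℝ, 0 < t →
    ∫⁻ y, min ((π.map Prod.snd).rnDeriv νY y) (ENNReal.ofReal t) ∂νY = Fit E νX νY t

/-- Coefficient pairs `(a, b)` of the affine functions `t ↦ a + b * t` lying below `θ` on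
`[0, ∞)`. -/
def affineMinorants (θ : ℝ → EReal) : Set (ℝ × ℝ) :=
  {p | ∀ t : ℝ, 0 ≤ t → ((p.1 + p.2 * t : ℝ) : EReal) ≤ θ t}

theorem ProperConvexLSCOn.exists_separating {θ : ℝ → EReal} (hθ : ProperConvexLSCOn θ)
    {t₀ s : ℝ} (hs : (s : EReal) < θ t₀) :
    ∃ α β u : ℝ, α * t₀ + β * s < u ∧
      ∀ t σ : ℝ, 0 ≤ t → θ t ≤ (σ : EReal) → u < α * t + β * σ := by
  have hcl : IsClosed {p : ℝ × ℝ | 0 ≤ p.1 ∧ θ p.1 ≤ (p.2 : EReal)} := by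
    have h := (lowerSemicontinuousOn_iff_isClosed_epigraph isClosed_Ici).1 hθ.lsc
    exact h.preimage (f := fun p : ℝ × ℝ => (p.1, (p.2 : EReal)))
      (continuous_fst.prodMk (continuous_coe_real_ereal.comp continuous_snd))
  have hcv : Convex ℝ {p : ℝ × ℝ | 0 ≤ p.1 ∧ θ p.1 ≤ (p.2 : EReal)} := by
    rintro ⟨x, σ⟩ ⟨hx, hxσ⟩ ⟨y, τ⟩ ⟨hy, hyτ⟩ a b ha hb hab
    simp only at hx hxσ hy hyτ
    refine ⟨?_, (hθ.convex x y a b hx hy ha hb hab).trans ?_⟩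
    · simp only [Prod.fst_add, Prod.smul_fst, smul_eq_mul]; positivity
    · simp only [Prod.snd_add, Prod.smul_snd, smul_eq_mul, EReal.coe_add, EReal.coe_mul]
      gcongr
  obtain ⟨f, u, h1, h2⟩ := geometric_hahn_banach_point_closed hcv hcl
    (x := (t₀, s)) (fun h => absurd h.2 (not_le.2 hs))
  have key : ∀ t σ : ℝ, f (t, σ) = f (1, 0) * t + f (0, 1) * σ := by
    intro t σ
    have : ((t, σ) : ℝ × ℝ) = t • (1, 0) + σ • (0, 1) := by simp
    rw [this, map_add, map_smul, map_smul]; simp [mul_comm]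
  refine ⟨f (1, 0), f (0, 1), u, by rwa [← key], fun t σ ht hσ => ?_⟩
  rw [← key]; exact h2 _ ⟨ht, hσ⟩

theorem ProperConvexLSCOn.mem_affineMinorants {θ : ℝ → EReal} (hθ : ProperConvexLSCOn θ)
    {a b : ℝ} (h : ∀ t σ : ℝ, 0 ≤ t → θ t ≤ (σ : EReal) → a + b * t ≤ σ) :
    (a, b) ∈ affineMinorants θ := by
  intro t ht
  induction hv : θ t using EReal.rec with
  | bot => exact absurd hv (hθ.ne_bot t ht)
  | top => exact le_top
  | coe σ => exact_mod_cast h t σ ht hv.le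

theorem ProperConvexLSCOn.exists_affineMinorant_of_pos {θ : ℝ → EReal} (hθ : ProperConvexLSCOn θ)
    {t₀ s α β u : ℝ} (hβ : 0 < β) (h : α * t₀ + β * s < u)
    (h' : ∀ t σ : ℝ, 0 ≤ t → θ t ≤ (σ : EReal) → u < α * t + β * σ) :
    ∃ p ∈ affineMinorants θ, s < p.1 + p.2 * t₀ := by
  refine ⟨(u / β, -α / β), hθ.mem_affineMinorants fun t σ ht hσ => ?_, ?_⟩
  · have := h' t σ ht hσ
    rw [div_mul_eq_mul_div, ← add_div, div_le_iff₀ hβ]; linarith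
  · simp only
    rw [div_mul_eq_mul_div, ← add_div, lt_div_iff₀ hβ]; linarith

theorem ProperConvexLSCOn.nonempty_affineMinorants {θ : ℝ → EReal} (hθ : ProperConvexLSCOn θ) :
    (affineMinorants θ).Nonempty := by
  obtain ⟨t, ht, htop⟩ := hθ.exists_ne_top
  lift θ t to ℝ using ⟨htop, hθ.ne_bot t ht⟩ with v hv
  obtain ⟨α, β, u, h, h'⟩ := hθ.exists_separating (t₀ := t) (s := v - 1)
    (by rw [← hv]; exact_mod_cast sub_one_lt v)
  have := h' t v ht hv.ge
  obtain ⟨p, hp, -⟩ := hθ.exists_affineMinorant_of_pos (by linarith) h h'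
  exact ⟨p, hp⟩

theorem ProperConvexLSCOn.exists_affineMinorant_gt {θ : ℝ → EReal} (hθ : ProperConvexLSCOn θ)
    {t₀ s : ℝ} (hs : (s : EReal) < θ t₀) :
    ∃ p ∈ affineMinorants θ, s < p.1 + p.2 * t₀ := by
  obtain ⟨α, β, u, h, h'⟩ := hθ.exists_separating hs
  obtain ⟨t, ht, htop⟩ := hθ.exists_ne_top
  lift θ t to ℝ using ⟨htop, hθ.ne_bot t ht⟩ with v hv
  have hβ : 0 ≤ β := by
    by_contra! hneg
    obtain ⟨M, hM1, hM2⟩ : ∃ M : ℝ, v ≤ M ∧ (u - α * t) / β ≤ M :=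
      ⟨max v ((u - α * t) / β), le_max_left _ _, le_max_right _ _⟩
    have := h' t M ht (by rw [← hv]; exact_mod_cast hM1)
    rw [div_le_iff_of_neg hneg] at hM2
    linarith
  rcases hβ.lt_or_eq with hpos | rfl
  · exact hθ.exists_affineMinorant_of_pos hpos h h'
  · obtain ⟨⟨a, b⟩, hab⟩ := hθ.nonempty_affineMinorants
    simp only [zero_mul, add_zero] at h h'
    have hd : 0 < u - α * t₀ := by linarith
    obtain ⟨l, hl0, hl⟩ : ∃ l : ℝ, 0 ≤ l ∧ s - (a + b * t₀) < l * (u - α * t₀) := by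
      refine ⟨max 0 ((s - (a + b * t₀)) / (u - α * t₀) + 1), le_max_left _ _, ?_⟩
      rw [← div_lt_iff₀ hd]
      exact (lt_add_one _).trans_le (le_max_right _ _)
    refine ⟨(a + l * u, b - l * α), hθ.mem_affineMinorants fun x σ hx hσ => ?_, ?_⟩
    · have h1 : a + b * x ≤ σ := by exact_mod_cast (hab x hx).trans hσ
      have h2 : l * u ≤ l * (α * x) := by gcongr; exact (h' x σ hx hσ).le
      linarith
    · simp only; linarith

theorem ProperConvexLSCOn.exists_affine_seq {θ : ℝ → EReal} (hθ : ProperConvexLSCOn θ) :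
    ∃ a b : ℕ → ℝ, (∀ k, (a k, b k) ∈ affineMinorants θ) ∧
      ∀ t : ℝ, 0 ≤ t → θ t = ⨆ k, ((a k + b k * t : ℝ) : EReal) := by
  have : Nonempty (affineMinorants θ) := hθ.nonempty_affineMinorants.to_subtype
  let q := TopologicalSpace.denseSeq (affineMinorants θ)
  refine ⟨fun k => (q k).1.1, fun k => (q k).1.2, fun k => (q k).2, fun t ht => le_antisymm ?_
    (iSup_le fun k => (q k).2 t ht)⟩
  refine le_of_forall_lt fun c hc => ?_
  obtain ⟨s, hcs, hs⟩ := EReal.lt_iff_exists_real_btwn.1 hc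
  obtain ⟨p, hp, hps⟩ := hθ.exists_affineMinorant_gt hs
  have hopen : IsOpen {p : affineMinorants θ | s < p.1.1 + p.1.2 * t} :=
    isOpen_lt (by fun_prop) (by fun_prop)
  obtain ⟨k, hk⟩ := (TopologicalSpace.denseRange_denseSeq (affineMinorants θ)).exists_mem_open
    hopen ⟨⟨p, hp⟩, hps⟩
  refine hcs.trans (lt_of_lt_of_le ?_ (le_iSup _ k))
  exact_mod_cast hk

theorem ProperConvexLSCOn.recessionSlope_eq {θ : ℝ → EReal} (hθ : ProperConvexLSCOn θ)
    {a b : ℕ → ℝ} (h : ∀ t : ℝ, 0 ≤ t → θ t = ⨆ k, ((a k + b k * t : ℝ) : EReal)) :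
    recessionSlope θ = ⨆ k, (b k : EReal) := by
  refine le_antisymm ?_ (iSup_le fun k => ?_)
  · induction hB : ⨆ k, (b k : EReal) using EReal.rec with
    | bot => exact absurd (hB ▸ le_iSup (fun k => (b k : EReal)) 0) (by simp)
    | top => exact le_top
    | coe B =>
      have hb : ∀ k, b k ≤ B := fun k => by
        exact_mod_cast hB ▸ le_iSup (fun k => (b k : EReal)) k
      obtain ⟨t₀, ht₀, htop⟩ := hθ.exists_ne_top
      lift θ t₀ to ℝ using ⟨htop, hθ.ne_bot t₀ ht₀⟩ with v hv
      have hak : ∀ k, a k + b k * t₀ ≤ v := fun k => by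
        have := le_iSup (fun k => ((a k + b k * t₀ : ℝ) : EReal)) k
        rw [← h t₀ ht₀, ← hv] at this
        exact_mod_cast this
      have hlim : Tendsto (fun t : ℝ => (((v - B * t₀) * t⁻¹ + B : ℝ) : EReal)) atTop (nhds B) := by
        refine (continuous_coe_real_ereal.tendsto B).comp ?_
        simpa using (tendsto_inv_atTop_zero.const_mul (v - B * t₀)).add_const B
      rw [← hlim.limsup_eq]
      refine limsup_le_limsup ?_
      filter_upwards [eventually_ge_atTop t₀, eventually_gt_atTop 0] with t ht htpos
      have h1 : θ t ≤ ((v - B * t₀ + B * t : ℝ) : EReal) := by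
        rw [h t htpos.le]
        refine iSup_le fun k => EReal.coe_le_coe_iff.2 ?_
        nlinarith [hak k, mul_le_mul_of_nonneg_right (hb k) (sub_nonneg.2 ht)]
      calc θ t * ((t⁻¹ : ℝ) : EReal)
          ≤ ((v - B * t₀ + B * t : ℝ) : EReal) * ((t⁻¹ : ℝ) : EReal) := by
            gcongr
        _ = (((v - B * t₀) * t⁻¹ + B : ℝ) : EReal) := by
            rw [← EReal.coe_mul]; congr 1; field_simp
  · have hlim : Tendsto (fun t : ℝ => ((a k * t⁻¹ + b k : ℝ) : EReal)) atTop (nhds (b k)) := by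
      refine (continuous_coe_real_ereal.tendsto _).comp ?_
      simpa using (tendsto_inv_atTop_zero.const_mul (a k)).add_const (b k)
    rw [← hlim.limsup_eq]
    refine limsup_le_limsup ?_
    filter_upwards [eventually_gt_atTop 0] with t htpos
    calc ((a k * t⁻¹ + b k : ℝ) : EReal)
        = ((a k + b k * t : ℝ) : EReal) * ((t⁻¹ : ℝ) : EReal) := by
          rw [← EReal.coe_mul]; congr 1; field_simp
      _ ≤ θ t * ((t⁻¹ : ℝ) : EReal) := by
          gcongr
          rw [h t htpos.le]; exact le_iSup (fun k => ((a k + b k * t : ℝ) : EReal)) k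

/-- A continuous map on a compact metrizable space has a Borel right inverse on its range. -/
theorem exists_measurable_rightInverse_of_compact {K X : Type*} [TopologicalSpace K]
    [CompactSpace K] [TopologicalSpace.MetrizableSpace K] [Nonempty K] [MeasurableSpace K]
    [BorelSpace K] [TopologicalSpace X] [T2Space X] [MeasurableSpace X] [OpensMeasurableSpace X]
    {p : K → X} (hp : Continuous p) :
    ∃ s : X → K, Measurable s ∧ ∀ x ∈ Set.range p, p (s x) = x := by
  classical
  let := TopologicalSpace.metrizableSpaceMetric K
  obtain ⟨q₀, hq₀, hq₀s⟩ := exists_nat_bool_continuous_surjective_of_compact K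
  let q : cantorSet → K := q₀ ∘ cantorSetHomeomorphNatToBool
  have hq : Continuous q := hq₀.comp cantorSetHomeomorphNatToBool.continuous
  have hqs : Function.Surjective q := hq₀s.comp cantorSetHomeomorphNatToBool.surjective
  have : CompactSpace cantorSet := isCompact_iff_compactSpace.1 isCompact_cantorSet
  have hr : Continuous (p ∘ q) := hp.comp hq
  have hmin : ∀ x ∈ Set.range p, ∃ t : cantorSet, p (q t) = x ∧
      ∀ t' : cantorSet, p (q t') = x → t ≤ t' := by
    rintro _ ⟨k, rfl⟩
    obtain ⟨t, rfl⟩ := hqs k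
    have hc : IsCompact ((p ∘ q) ⁻¹' {p (q t)}) :=
      (isClosed_singleton.preimage hr).isCompact
    obtain ⟨t₁, ht₁, hle⟩ := hc.exists_isLeast ⟨t, rfl⟩
    exact ⟨t₁, ht₁, fun t' ht' => hle ht'⟩
  let t₀ : cantorSet := ⟨0, zero_mem_cantorSet⟩
  have : Nonempty cantorSet := ⟨t₀⟩
  choose! m hm hle using hmin
  have hrange : MeasurableSet (Set.range p) := (isCompact_range hp).isClosed.measurableSet
  let m' : X → cantorSet := fun x => if x ∈ Set.range p then m x else t₀
  have hm' : Measurable m' := by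
    suffices h : Measurable fun x => (m' x : ℝ) from h.subtype_mk (h := fun x => (m' x).2)
    refine measurable_of_Iic fun c => ?_
    have hcl : IsClosed ((p ∘ q) '' {t | (t : ℝ) ≤ c}) :=
      ((isClosed_le continuous_subtype_val continuous_const).isCompact.image hr).isClosed
    have : (fun x => (m' x : ℝ)) ⁻¹' Set.Iic c =
        (p ∘ q) '' {t | (t : ℝ) ≤ c} ∪ ((Set.range p)ᶜ ∩ {_x | (t₀ : ℝ) ≤ c}) := by
      ext x
      by_cases hx : x ∈ Set.range p
      · simp only [m', Set.mem_preimage, hx, if_true, Set.mem_Iic, Set.mem_union, Set.mem_image,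
          Set.mem_inter_iff, Set.mem_compl_iff, not_true, false_and, or_false]
        exact ⟨fun h => ⟨m x, h, hm x hx⟩, fun ⟨t, ht, htx⟩ => (Subtype.coe_le_coe.2 (hle x hx t htx)).trans ht⟩
      · have : x ∉ (p ∘ q) '' {t | (t : ℝ) ≤ c} := fun ⟨t, _, ht⟩ => hx ⟨_, ht⟩
        simp only [m', Set.mem_preimage, hx, if_false, Set.mem_Iic, Set.mem_union, this,
          Set.mem_inter_iff, Set.mem_compl_iff, not_false_eq_true, true_and, false_or,
          Set.mem_ofPred_eq]
    rw [this]
    exact hcl.measurableSet.union (hrange.compl.inter (MeasurableSet.const _))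
  refine ⟨q ∘ m', hq.measurable.comp hm', fun x hx => ?_⟩
  simp only [Function.comp_apply, m', hx, if_true]
  exact hm x hx

/-- Continuous images of the Baire space are inner regular with respect to images of compact
sets. -/
theorem exists_isCompact_le_measure_image {X : Type*} [TopologicalSpace X]
    [TopologicalSpace.MetrizableSpace X] [MeasurableSpace X] [BorelSpace X]
    {p : (ℕ → ℕ) → X} (hp : Continuous p) (μ : Measure X) [IsFiniteMeasure μ] {c : ℝ≥0∞}
    (hc : c < μ (Set.range p)) : ∃ K : Set (ℕ → ℕ), IsCompact K ∧ c ≤ μ (p '' K) := by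
  have hstep : ∀ (A : Set (ℕ → ℕ)) (k : ℕ), c < μ (p '' A) →
      ∃ m : ℕ, c < μ (p '' (A ∩ {z | z k ≤ m})) := by
    intro A k hA
    have hmono : Monotone fun m : ℕ => p '' (A ∩ {z | z k ≤ m}) := fun m m' h =>
      Set.image_mono (Set.inter_subset_inter_right _ fun z (hz : z k ≤ m) => hz.trans h)
    have hU : ⋃ m : ℕ, p '' (A ∩ {z | z k ≤ m}) = p '' A := by
      rw [← Set.image_iUnion, ← Set.inter_iUnion]
      congr 1
      exact Set.inter_eq_left.2 fun z _ => Set.mem_iUnion.2 ⟨z k, le_refl (z k)⟩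
    rw [← hU, hmono.measure_iUnion] at hA
    exact lt_iSup_iff.1 hA
  choose! m hm using hstep
  let A : ℕ → Set (ℕ → ℕ) := fun k =>
    Nat.rec Set.univ (fun k A => A ∩ {z | z k ≤ m A k}) k
  have hAs : ∀ k, A (k + 1) = A k ∩ {z | z k ≤ m (A k) k} := fun k => rfl
  have hAc : ∀ k, c < μ (p '' A k) := by
    intro k
    induction k with
    | zero => simpa [A] using hc
    | succ k ih => rw [hAs]; exact hm _ _ ih
  have hAanti : Antitone A := antitone_nat_of_succ_le fun k => by
    rw [hAs]; exact Set.inter_subset_left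
  let n : ℕ → ℕ := fun k => m (A k) k
  have hAn : ∀ k z, z ∈ A k → ∀ i < k, z i ≤ n i := fun k z hz i hi =>
    ((hAs i ▸ hAanti (Nat.succ_le_of_lt hi) hz : z ∈ A i ∩ {z | z i ≤ m (A i) i})).2
  have hK : IsCompact (Set.univ.pi fun i => Set.Iic (n i)) :=
    isCompact_univ_pi fun i => (Set.finite_Iic (n i)).isCompact
  refine ⟨_, hK, ?_⟩
  have hsub : ⋂ k, closure (p '' A k) ⊆ p '' (Set.univ.pi fun i => Set.Iic (n i)) := by
    intro x hx
    obtain ⟨U, hU⟩ := (nhds x).exists_antitone_basis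
    have hz : ∀ k, ∃ z ∈ A k, p z ∈ U k := fun k => by
      obtain ⟨y, hyU, z, hz, rfl⟩ :=
        mem_closure_iff_nhds.1 (Set.mem_iInter.1 hx k) (U k) (hU.1.mem_of_mem trivial)
      exact ⟨z, hz, hyU⟩
    choose z hzA hzU using hz
    have hlim : Tendsto (fun k => p (z k)) atTop (nhds x) := hU.tendsto hzU
    obtain ⟨w, hw, φ, hφ, hφw⟩ := hK.tendsto_subseq (x := fun k i => min (z k i) (n i))
      (fun k i _ => Set.mem_Iic.2 (min_le_right _ _))
    have hzw : Tendsto (fun j => z (φ j)) atTop (nhds w) := by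
      rw [tendsto_pi_nhds] at hφw ⊢
      intro i
      refine (hφw i).congr' ?_
      filter_upwards [eventually_gt_atTop i] with j hj
      exact min_eq_left (hAn _ _ (hzA (φ j)) i (hj.trans_le (hφ.id_le j)))
    exact ⟨w, hw, tendsto_nhds_unique ((hp.tendsto w).comp hzw) (hlim.comp hφ.tendsto_atTop)⟩
  refine le_trans ?_ (measure_mono hsub)
  have hanti : Antitone fun k => closure (p '' A k) := fun k l h =>
    closure_mono (Set.image_mono (hAanti h))
  rw [hanti.measure_iInter (fun k => isClosed_closure.measurableSet.nullMeasurableSet)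
    ⟨0, measure_ne_top _ _⟩]
  exact le_iInf fun k => (hAc k).le.trans (measure_mono subset_closure)

/-- A continuous surjection between Polish spaces has a Borel almost everywhere right inverse
with respect to any finite measure. -/
theorem exists_measurable_ae_rightInverse {Z X : Type*} [TopologicalSpace Z] [PolishSpace Z]
    [Nonempty Z] [MeasurableSpace Z] [BorelSpace Z] [TopologicalSpace X] [PolishSpace X]
    [MeasurableSpace X] [BorelSpace X] {p : Z → X} (hp : Continuous p)
    (hps : Function.Surjective p) (μ : Measure X) [IsFiniteMeasure μ] :
    ∃ s : X → Z, Measurable s ∧ ∀ᵐ x ∂μ, p (s x) = x := by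
  classical
  rcases eq_or_ne μ 0 with rfl | hμ
  · exact ⟨fun _ => Classical.arbitrary Z, measurable_const, by simp⟩
  obtain ⟨g, hg, hgs⟩ := PolishSpace.exists_nat_nat_continuous_surjective Z
  have hpg : Continuous (p ∘ g) := hp.comp hg
  have hrange : Set.range (p ∘ g) = Set.univ := (hps.comp hgs).range_eq
  obtain ⟨c, -, hc, hclim⟩ := exists_seq_strictMono_tendsto' (x := μ Set.univ) (y := (0 : ℝ≥0∞))
    (pos_iff_ne_zero.2 (mt Measure.measure_univ_eq_zero.1 hμ))
  have hK : ∀ m, ∃ K : Set (ℕ → ℕ), IsCompact K ∧ c m ≤ μ ((p ∘ g) '' K) := fun m =>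
    exists_isCompact_le_measure_image hpg μ (by rw [hrange]; exact (hc m).2)
  choose K hKc hKμ using hK
  have hs : ∀ m, ∃ s : X → Z, Measurable s ∧ ∀ x ∈ (p ∘ g) '' K m, p (s x) = x := by
    intro m
    have hne : (K m).Nonempty := by
      by_contra h
      rw [Set.not_nonempty_iff_eq_empty] at h
      have := hKμ m
      rw [h] at this
      simp only [Set.image_empty, measure_empty, nonpos_iff_eq_zero] at this
      exact (hc m).1.ne' this
    have := hne.to_subtype
    have := isCompact_iff_compactSpace.1 (hKc m)
    obtain ⟨s, hs, hsx⟩ := exists_measurable_rightInverse_of_compact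
      (p := fun z : K m => p (g z)) (hpg.comp continuous_subtype_val)
    refine ⟨fun x => g (s x), hg.measurable.comp (measurable_subtype_coe.comp hs), ?_⟩
    rintro x ⟨z, hz, rfl⟩
    exact hsx _ ⟨⟨z, hz⟩, rfl⟩
  choose s hsm hsx using hs
  have hmeas : ∀ m, MeasurableSet ((p ∘ g) '' K m) := fun m =>
    ((hKc m).image hpg).isClosed.measurableSet
  let L : Set X := ⋃ m, (p ∘ g) '' K m
  have hL : MeasurableSet L := MeasurableSet.iUnion hmeas
  have hex : ∀ x, ∃ m, x ∈ (p ∘ g) '' K m ∪ Lᶜ := fun x => by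
    by_cases hx : x ∈ L
    · obtain ⟨m, hm⟩ := Set.mem_iUnion.1 hx
      exact ⟨m, Or.inl hm⟩
    · exact ⟨0, Or.inr hx⟩
  refine ⟨fun x => s (Nat.find (hex x)) x,
    Measurable.find (p := fun m x => x ∈ (p ∘ g) '' K m ∪ Lᶜ) hsm (fun m => (hmeas m).union hL.compl) hex, ?_⟩
  have hLc : μ Lᶜ = 0 := by
    rw [measure_compl hL (measure_ne_top _ _), tsub_eq_zero_iff_le]
    exact le_of_tendsto' hclim fun m => (hKμ m).trans
      (measure_mono (Set.subset_iUnion (fun m => (p ∘ g) '' K m) m))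
  have hLae : ∀ᵐ x ∂μ, x ∈ L := hLc
  filter_upwards [hLae] with x hx
  rcases Nat.find_spec (hex x) with h | h
  · exact hsx _ _ h
  · exact absurd hx h

/-- A closed relation whose left projection is surjective contains the graph of a Borel map,
up to a null set. -/
theorem exists_measurable_ae_mem_of_isClosed {X Y : Type*} [TopologicalSpace X] [PolishSpace X]
    [MeasurableSpace X] [BorelSpace X] [TopologicalSpace Y] [PolishSpace Y] [MeasurableSpace Y]
    [BorelSpace Y] [Nonempty X] {E : Set (X × Y)} (hE : IsClosed E)
    (hN : ∀ x, ∃ y, (x, y) ∈ E) (μ : Measure X) [IsFiniteMeasure μ] :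
    ∃ h : X → Y, Measurable h ∧ ∀ᵐ x ∂μ, (x, h x) ∈ E := by
  have := hE.polishSpace
  obtain ⟨x₀⟩ := ‹Nonempty X›
  obtain ⟨y₀, h₀⟩ := hN x₀
  have : Nonempty E := ⟨⟨_, h₀⟩⟩
  obtain ⟨s, hs, hsx⟩ := exists_measurable_ae_rightInverse (p := fun z : E => z.1.1)
    (continuous_fst.comp continuous_subtype_val)
    (fun x => let ⟨y, hy⟩ := hN x; ⟨⟨(x, y), hy⟩, rfl⟩) μ
  refine ⟨fun x => (s x).1.2, measurable_snd.comp (measurable_subtype_coe.comp hs), ?_⟩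
  filter_upwards [hsx] with x hx
  have h := (s x).2
  rwa [← Prod.mk.eta (p := (s x).1), hx] at h

theorem EReal.iSup_coe_eq_coe_iSup_ofReal_sub_add (x : ℕ → ℝ) :
    ⨆ k, (x k : EReal) = ((⨆ k, ENNReal.ofReal (x k - x 0) : ℝ≥0∞) : EReal) + (x 0 : EReal) := by
  refine le_antisymm (iSup_le fun k => ?_) ?_
  · have h1 : ((x k - x 0 : ℝ) : EReal) ≤ ((⨆ k, ENNReal.ofReal (x k - x 0) : ℝ≥0∞) : EReal) :=
      (EReal.coe_le_coe_iff.2 (le_max_left _ 0)).trans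
        (by rw [← EReal.coe_ennreal_ofReal]
            exact EReal.coe_ennreal_le_coe_ennreal_iff.2
              (le_iSup (fun k => ENNReal.ofReal (x k - x 0)) k))
    calc (x k : EReal) = ((x k - x 0 : ℝ) : EReal) + (x 0 : EReal) := by
          rw [← EReal.coe_add]; congr 1; ring
      _ ≤ _ := by gcongr
  · set s := ⨆ k, (x k : EReal) with hs
    have hx : ∀ k, (x k : EReal) ≤ s := le_iSup (fun k => (x k : EReal))
    have h0 : 0 ≤ s - (x 0 : EReal) := by
      rw [EReal.sub_nonneg (by simp) (by simp)]; exact hx 0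
    have h : ⨆ k, ENNReal.ofReal (x k - x 0) ≤ (s - (x 0 : EReal)).toENNReal := by
      refine iSup_le fun k => ?_
      rw [← EReal.real_coe_toENNReal, EReal.coe_sub]
      exact EReal.toENNReal_le_toENNReal (EReal.sub_le_sub (hx k) le_rfl)
    have h' := EReal.coe_ennreal_le_coe_ennreal_iff.2 h
    rw [EReal.coe_toENNReal h0] at h'
    calc _ ≤ s - (x 0 : EReal) + (x 0 : EReal) := by gcongr
      _ = s := EReal.sub_add_cancel

theorem erealIntegral_coe_add_coe {Ω : Type} [MeasurableSpace Ω] {μ : Measure Ω}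
    {f : Ω → ℝ≥0∞} (hf : Measurable f) {l : Ω → ℝ} (hl : Integrable l μ) :
    erealIntegral μ (fun x => (f x : EReal) + (l x : EReal)) =
      ((∫⁻ x, f x ∂μ : ℝ≥0∞) : EReal) + ((∫ x, l x ∂μ : ℝ) : EReal) := by
  set p : Ω → ℝ≥0∞ := fun x => erealToENNReal ((f x : EReal) + (l x : EReal)) with hp
  set n : Ω → ℝ≥0∞ := fun x => erealToENNReal (-((f x : EReal) + (l x : EReal))) with hn
  have hpt : ∀ x, f x + ENNReal.ofReal (l x) + n x = p x + ENNReal.ofReal (-l x) ∧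
      n x ≤ ENNReal.ofReal (-l x) := by
    intro x
    simp only [hp, hn]
    rcases eq_or_ne (f x) ⊤ with h | h
    · simp [h, erealToENNReal]
    · lift f x to ℝ≥0 using h with v hv
      have e1 : erealToENNReal ((v : ℝ≥0∞) + (l x : EReal)) = ENNReal.ofReal (v + l x) := by
        rw [show (((v : ℝ≥0∞) : EReal) + (l x : EReal)) = (((v : ℝ) + l x : ℝ) : EReal) by
          rw [EReal.coe_add]; rfl]
        simp [erealToENNReal, -EReal.coe_add]
      have e2 : erealToENNReal (-((v : ℝ≥0∞) + (l x : EReal))) = ENNReal.ofReal (-(v + l x)) := by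
        rw [show (-(((v : ℝ≥0∞) : EReal) + (l x : EReal))) = ((-((v : ℝ) + l x) : ℝ) : EReal) by
          rw [EReal.coe_neg, EReal.coe_add]; rfl]
        simp [erealToENNReal, -EReal.coe_add, -EReal.coe_neg, -neg_add_rev]
      rw [e1, e2]
      have hv0 : (0 : ℝ) ≤ v := v.2
      refine ⟨?_, ENNReal.ofReal_le_ofReal (by linarith)⟩
      rw [← ENNReal.ofReal_coe_nnreal]
      rcases le_total 0 (l x) with h1 | h1 <;> rcases le_total 0 (v + l x) with h2 | h2
      · rw [ENNReal.ofReal_of_nonpos (neg_nonpos.2 h1), ENNReal.ofReal_of_nonpos (neg_nonpos.2 h2),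
          ← ENNReal.ofReal_add hv0 h1]
      · have : l x = 0 := by linarith
        have : (v : ℝ) = 0 := by linarith
        simp_all
      · rw [ENNReal.ofReal_of_nonpos h1, ENNReal.ofReal_of_nonpos (neg_nonpos.2 h2),
          ← ENNReal.ofReal_add h2 (by linarith)]
        simp
      · rw [ENNReal.ofReal_of_nonpos h1, ENNReal.ofReal_of_nonpos h2, add_zero, zero_add,
          ← ENNReal.ofReal_add hv0 (by linarith)]
        congr 1; ring
  have hlp : AEMeasurable (fun x => ENNReal.ofReal (l x)) μ := hl.1.aemeasurable.ennreal_ofReal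
  have hln : AEMeasurable (fun x => ENNReal.ofReal (-l x)) μ :=
    hl.1.aemeasurable.neg.ennreal_ofReal
  have hsum : ∫⁻ x, f x ∂μ + ∫⁻ x, ENNReal.ofReal (l x) ∂μ + ∫⁻ x, n x ∂μ =
      ∫⁻ x, p x ∂μ + ∫⁻ x, ENNReal.ofReal (-l x) ∂μ := by
    rw [← lintegral_add_left hf, ← lintegral_add_left' (show AEMeasurable (fun x => f x + ENNReal.ofReal (l x)) μ from
      hf.aemeasurable.add hlp),
      ← lintegral_add_right' _ hln]
    exact lintegral_congr fun x => (hpt x).1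
  have hA : ∫⁻ x, ENNReal.ofReal (l x) ∂μ ≠ ⊤ := hl.lintegral_lt_top.ne
  have hB : ∫⁻ x, ENNReal.ofReal (-l x) ∂μ ≠ ⊤ := hl.neg.lintegral_lt_top.ne
  have hN : ∫⁻ x, n x ∂μ ≠ ⊤ := ne_top_of_le_ne_top hB (lintegral_mono fun x => (hpt x).2)
  rw [erealIntegral, integral_eq_lintegral_pos_part_sub_lintegral_neg_part hl]
  change ((∫⁻ x, p x ∂μ : ℝ≥0∞) : EReal) - ((∫⁻ x, n x ∂μ : ℝ≥0∞) : EReal) = _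
  generalize ∫⁻ x, p x ∂μ = P at *
  generalize ∫⁻ x, n x ∂μ = N at *
  generalize ∫⁻ x, f x ∂μ = F at *
  generalize ∫⁻ x, ENNReal.ofReal (l x) ∂μ = A at *
  generalize ∫⁻ x, ENNReal.ofReal (-l x) ∂μ = B at *
  lift A to ℝ≥0 using hA
  lift B to ℝ≥0 using hB
  lift N to ℝ≥0 using hN
  rcases eq_or_ne F ⊤ with rfl | hF
  · have : P = ⊤ := by simpa using hsum.symm
    subst this
    rfl
  · lift F to ℝ≥0 using hF
    have hP : P ≠ ⊤ := by
      rintro rfl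
      simp [← ENNReal.coe_add] at hsum
    lift P to ℝ≥0 using hP
    have h : (F : ℝ) + A + N = P + B := by exact_mod_cast hsum
    change (((P : ℝ) : EReal) - ((N : ℝ) : EReal)) = ((F : ℝ) : EReal) + (((A : ℝ) - B : ℝ) : EReal)
    rw [← EReal.coe_sub, ← EReal.coe_add]
    congr 1; linarith

/-- The divergence of the supremum of the affine functions `t ↦ (a k - a 0) + (b k - b 0) * t`,
which is nonnegative. -/
def shiftedDiv {Ω : Type*} [MeasurableSpace Ω] (a b : ℕ → ℝ) (P Q : Measure Ω) : ℝ≥0∞ :=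
  ∫⁻ x, ⨆ k, ENNReal.ofReal (a k - a 0 + (b k - b 0) * (P.rnDeriv Q x).toReal) ∂Q +
    (⨆ k, ENNReal.ofReal (b k - b 0)) * P.singularPart Q Set.univ

theorem thetaDiv_eq_shiftedDiv_add {Ω : Type} [MeasurableSpace Ω] {θ : ℝ → EReal} {a b : ℕ → ℝ}
    (h : ∀ t : ℝ, 0 ≤ t → θ t = ⨆ k, ((a k + b k * t : ℝ) : EReal))
    (hrec : recessionSlope θ = ⨆ k, (b k : EReal))
    (P Q : Measure Ω) [IsFiniteMeasure P] [IsFiniteMeasure Q] :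
    thetaDiv θ P Q = ((shiftedDiv a b P Q : ℝ≥0∞) : EReal) +
      ((a 0 * Q.real Set.univ + b 0 * P.real Set.univ : ℝ) : EReal) := by
  have hl : Integrable (fun x => a 0 + b 0 * (P.rnDeriv Q x).toReal) Q :=
    (integrable_const _).add (Measure.integrable_toReal_rnDeriv.const_mul _)
  have hf : Measurable fun x =>
      ⨆ k, ENNReal.ofReal (a k - a 0 + (b k - b 0) * (P.rnDeriv Q x).toReal) := by
    fun_prop
  have hint : erealIntegral Q (fun x => θ ((P.rnDeriv Q x).toReal)) =
      ((∫⁻ x, ⨆ k, ENNReal.ofReal (a k - a 0 + (b k - b 0) * (P.rnDeriv Q x).toReal) ∂Q : ℝ≥0∞) :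
        EReal) + ((a 0 * Q.real Set.univ + b 0 * (P.real Set.univ -
          (P.singularPart Q).real Set.univ) : ℝ) : EReal) := by
    have : ∫ x, (a 0 + b 0 * (P.rnDeriv Q x).toReal) ∂Q = a 0 * Q.real Set.univ +
        b 0 * (P.real Set.univ - (P.singularPart Q).real Set.univ) := by
      rw [integral_add (integrable_const _) (Measure.integrable_toReal_rnDeriv.const_mul _),
        integral_const, integral_const_mul, Measure.integral_toReal_rnDeriv', smul_eq_mul, mul_comm]
    rw [← this, ← erealIntegral_coe_add_coe hf hl]
    congr 1
    ext x
    rw [h _ ENNReal.toReal_nonneg, EReal.iSup_coe_eq_coe_iSup_ofReal_sub_add]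
    simp only [sub_mul, add_sub_add_comm]
  have hS : P.singularPart Q Set.univ ≠ ⊤ := measure_ne_top _ _
  rw [thetaDiv, hint, hrec, EReal.iSup_coe_eq_coe_iSup_ofReal_sub_add, shiftedDiv,
    EReal.right_distrib_of_nonneg_of_ne_top (EReal.coe_ennreal_nonneg _)
      (mt EReal.coe_ennreal_eq_top_iff.1 hS),
    EReal.coe_ennreal_add, EReal.coe_ennreal_mul]
  have : (b 0 : EReal) * ((P.singularPart Q Set.univ : ℝ≥0∞) : EReal) =
      ((b 0 * (P.singularPart Q).real Set.univ : ℝ) : EReal) := by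
    rw [EReal.coe_mul, Measure.real, EReal.coe_ennreal_toReal hS]
  rw [this, add_add_add_comm, ← EReal.coe_add]
  congr 2; ring

theorem exists_measurable_argmax {Ω : Type*} [MeasurableSpace Ω] {v : ℕ → Ω → ℝ≥0∞}
    (hv : ∀ k, Measurable (v k)) (K : ℕ) :
    ∃ κ : Ω → ℕ, Measurable κ ∧ (∀ y, κ y ≤ K) ∧ ∀ y, ∀ k ≤ K, v k y ≤ v (κ y) y := by
  induction K with
  | zero => exact ⟨fun _ => 0, measurable_const, fun _ => le_rfl, fun y k hk => by simp_all⟩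
  | succ K ih =>
    obtain ⟨κ, hκ, hle, hmax⟩ := ih
    have hvκ : Measurable fun y => v (κ y) y :=
      (measurable_from_prod_countable_right (f := fun p : ℕ × Ω => v p.1 p.2) hv).comp
        (hκ.prodMk measurable_id)
    classical
    refine ⟨fun y => if v (κ y) y ≤ v (K + 1) y then K + 1 else κ y,
      Measurable.ite (measurableSet_le hvκ (hv _)) measurable_const hκ, fun y => ?_,
      fun y k hk => ?_⟩
    · dsimp only
      split_ifs
      · exact le_rfl
      · exact (hle y).trans K.le_succ
    · dsimp only
      rcases Nat.of_le_succ hk with h | rfl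
      · split_ifs with h'
        · exact (hmax y k h).trans h'
        · exact hmax y k h
      · split_ifs with h'
        · exact le_rfl
        · exact (not_le.1 h').le

theorem shiftedDiv_eq_iSup_min {Ω : Type*} [MeasurableSpace Ω] {P Q : Measure Ω} {a b : ℕ → ℝ} :
    shiftedDiv a b P Q = ⨆ K, shiftedDiv (fun k => a (min k K)) (fun k => b (min k K)) P Q := by
  have key : ∀ g : ℕ → ℝ≥0∞, (Monotone fun K => ⨆ k, g (min k K)) ∧
      ⨆ K, ⨆ k, g (min k K) = ⨆ k, g k := by
    intro g
    refine ⟨fun K L h => iSup_le fun k => ?_, le_antisymm ?_ ?_⟩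
    · refine le_iSup_of_le (min k K) ?_
      rw [min_eq_left ((min_le_right _ _).trans h)]
    · exact iSup_le fun K => iSup_le fun k => le_iSup g _
    · exact iSup_le fun k => le_iSup_of_le k (le_iSup_of_le k (by rw [min_self]))
  let F : ℕ → Ω → ℝ≥0∞ := fun k y => ENNReal.ofReal (a k - a 0 + (b k - b 0) *
    (P.rnDeriv Q y).toReal)
  let B : ℕ → ℝ≥0∞ := fun k => ENNReal.ofReal (b k - b 0)
  have hF : ∀ k, Measurable (F k) := fun k => by fun_prop
  change ∫⁻ y, ⨆ k, F k y ∂Q + (⨆ k, B k) * P.singularPart Q Set.univ = ⨆ K : ℕ,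
    (∫⁻ y, ⨆ k, F (min k K) y ∂Q + (⨆ k, B (min k K)) * P.singularPart Q Set.univ)
  rw [← ENNReal.iSup_add_iSup_of_monotone, ← lintegral_iSup, ← ENNReal.iSup_mul, (key B).2]
  · congr 2
    ext y
    exact ((key fun k => F k y).2).symm
  · exact fun K => Measurable.iSup fun k => hF _
  · exact fun K L h y => (key fun k => F k y).1 h
  · exact fun K L h => lintegral_mono fun y => (key fun k => F k y).1 h
  · exact fun K L h => mul_le_mul_left ((key B).1 h) _

/-- The value of the measurable competitor `κ` in the dual problem with slopes `w` and
intercepts `u`. -/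
def dualValue {Ω : Type*} [MeasurableSpace Ω] (u w : ℕ → ℝ≥0) (κ : Ω → ℕ) (P Q : Measure Ω) :
    ℝ≥0∞ :=
  ∫⁻ y, u (κ y) ∂Q + ∫⁻ y, w (κ y) ∂P

section Dual

variable {Ω : Type*} [MeasurableSpace Ω] {P Q : Measure Ω} [IsFiniteMeasure P] [IsFiniteMeasure Q]
  {a b : ℕ → ℝ} {u w : ℕ → ℝ≥0} {c : ℝ≥0} {K : ℕ}

theorem dualValue_eq_lintegral_add {κ : Ω → ℕ} (hκ : Measurable κ) :
    dualValue u w κ P Q = ∫⁻ y, (u (κ y) + P.rnDeriv Q y * w (κ y)) ∂Q +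
      ∫⁻ y, w (κ y) ∂(P.singularPart Q) := by
  have hu : Measurable fun y => (u (κ y) : ℝ≥0∞) :=
    (measurable_of_countable fun k => (u k : ℝ≥0∞)).comp hκ
  have hw : Measurable fun y => (w (κ y) : ℝ≥0∞) :=
    (measurable_of_countable fun k => (w k : ℝ≥0∞)).comp hκ
  rw [dualValue]
  conv_lhs => rw [P.haveLebesgueDecomposition_add Q]
  rw [lintegral_add_measure, lintegral_withDensity_eq_lintegral_mul _ (P.measurable_rnDeriv Q) hw,
    lintegral_add_left hu, add_assoc, add_comm (∫⁻ y, (w (κ y) : ℝ≥0∞) ∂(P.singularPart Q))]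
  rfl

theorem lintegral_const_add_rnDeriv_add :
    ∫⁻ y, ((c : ℝ≥0∞) + P.rnDeriv Q y * c) ∂Q + ∫⁻ _, (c : ℝ≥0∞) ∂(P.singularPart Q) =
      c * (Q Set.univ + P Set.univ) := by
  have := dualValue_eq_lintegral_add (P := P) (Q := Q) (u := fun _ => c) (w := fun _ => c)
    (κ := fun _ => 0) measurable_const
  rw [← this, dualValue, lintegral_const, lintegral_const, mul_add]

/-- Every measurable competitor gives a lower bound on the divergence. -/
theorem dualValue_le (hu : ∀ k ≤ K, (u k : ℝ) = a k - a 0 + c)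
    (hw : ∀ k ≤ K, (w k : ℝ) = b k - b 0 + c) {κ : Ω → ℕ} (hκ : Measurable κ)
    (hκK : ∀ y, κ y ≤ K) :
    dualValue u w κ P Q ≤ shiftedDiv a b P Q + c * (Q Set.univ + P Set.univ) := by
  rw [dualValue_eq_lintegral_add hκ, ← lintegral_const_add_rnDeriv_add, shiftedDiv,
    add_add_add_comm]
  gcongr
  · rw [← lintegral_add_right _ (by fun_prop)]
    refine lintegral_mono_ae ?_
    filter_upwards [P.rnDeriv_ne_top Q] with y hy
    generalize P.rnDeriv Q y = r at *
    lift r to ℝ≥0 using hy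
    have h := le_iSup (fun k => ENNReal.ofReal (a k - a 0 + (b k - b 0) * r)) (κ y)
    refine le_trans ?_ (add_le_add_left h _)
    rw [show (c : ℝ≥0∞) + r * c = ENNReal.ofReal (c + r * c) by
      rw [ENNReal.ofReal_add (by positivity) (by positivity), ENNReal.ofReal_mul (by positivity)]
      simp, show (u (κ y) : ℝ≥0∞) + r * w (κ y) = ENNReal.ofReal (u (κ y) + r * w (κ y)) by
      rw [ENNReal.ofReal_add (by positivity) (by positivity), ENNReal.ofReal_mul (by positivity)]
      simp]
    refine le_trans (ENNReal.ofReal_le_ofReal ?_) ENNReal.ofReal_add_le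
    rw [hu _ (hκK y), hw _ (hκK y)]
    linarith
  · rw [← lintegral_const, ← lintegral_add_right _ (by fun_prop)]
    refine lintegral_mono fun y => ?_
    have h := le_iSup (fun k => ENNReal.ofReal (b k - b 0)) (κ y)
    refine le_trans ?_ (add_le_add_left h _)
    rw [← ENNReal.ofReal_coe_nnreal, ← ENNReal.ofReal_coe_nnreal, hw _ (hκK y)]
    exact ENNReal.ofReal_add_le

/-- The divergence truncated to the first `K + 1` affine functions is realized by a measurable
competitor. -/
theorem exists_le_dualValue (hu : ∀ k ≤ K, (u k : ℝ) = a k - a 0 + c)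
    (hw : ∀ k ≤ K, (w k : ℝ) = b k - b 0 + c) :
    ∃ κ : Ω → ℕ, Measurable κ ∧ (∀ y, κ y ≤ K) ∧
      shiftedDiv (fun k => a (min k K)) (fun k => b (min k K)) P Q +
        c * (Q Set.univ + P Set.univ) ≤ dualValue u w κ P Q := by
  classical
  have hsing := P.mutuallySingular_singularPart Q
  set S := hsing.nullSet with hS
  have hSm : MeasurableSet S := hsing.measurableSet_nullSet
  obtain ⟨κ, hκ, hκK, hmax⟩ := exists_measurable_argmax
    (v := fun k y => if y ∈ S then (u k : ℝ≥0∞) + P.rnDeriv Q y * w k else w k)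
    (fun k => Measurable.ite hSm (by fun_prop) measurable_const) K
  refine ⟨κ, hκ, hκK, ?_⟩
  rw [dualValue_eq_lintegral_add hκ, ← lintegral_const_add_rnDeriv_add, shiftedDiv,
    add_add_add_comm]
  gcongr
  · rw [← lintegral_add_right _ (by fun_prop)]
    refine lintegral_mono_ae ?_
    have hQS : ∀ᵐ y ∂Q, y ∈ S := hsing.measure_compl_nullSet
    filter_upwards [P.rnDeriv_ne_top Q, hQS] with y hy hyS
    have hmax' := hmax y
    simp only [hyS, if_true] at hmax'
    rw [ENNReal.iSup_add]
    refine iSup_le fun k => ?_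
    have hk := hmax' _ (min_le_right k K)
    have h0 := hmax' _ K.zero_le
    have huk := hu _ (min_le_right k K)
    have hu0 := hu _ K.zero_le
    have hwk := hw _ (min_le_right k K)
    have hw0 := hw _ K.zero_le
    simp only [Nat.zero_min]
    generalize P.rnDeriv Q y = r at *
    lift r to ℝ≥0 using hy
    have e : ∀ s t : ℝ≥0, (s : ℝ≥0∞) + r * t = ENNReal.ofReal (s + r * t) := by
      intro s t
      rw [ENNReal.ofReal_add (by positivity) (by positivity), ENNReal.ofReal_mul (by positivity)]
      simp
    rw [ENNReal.coe_toReal]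
    rcases le_total 0 (a (min k K) - a 0 + (b (min k K) - b 0) * (r : ℝ)) with hpos | hneg
    · refine le_trans (le_of_eq ?_) hk
      rw [e, e, ← ENNReal.ofReal_add hpos (by positivity), huk, hwk]
      congr 1; ring
    · refine le_trans (le_of_eq ?_) h0
      rw [ENNReal.ofReal_of_nonpos hneg, zero_add, e, e, hu0, hw0]
      simp
  · rw [← lintegral_const, ← lintegral_add_right _ (by fun_prop)]
    refine lintegral_mono_ae ?_
    have hPS : ∀ᵐ y ∂(P.singularPart Q), y ∉ S := by
      simp only [ae_iff, not_not]; exact hsing.measure_nullSet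
    filter_upwards [hPS] with y hyS
    have hmax' := hmax y
    simp only [hyS, if_false] at hmax'
    rw [ENNReal.iSup_add]
    refine iSup_le fun k => ?_
    have hk := hmax' _ (min_le_right k K)
    have h0 := hmax' _ K.zero_le
    have hwk := hw _ (min_le_right k K)
    have hw0 := hw _ K.zero_le
    simp only [Nat.zero_min]
    rcases le_total 0 (b (min k K) - b 0) with hpos | hneg
    · refine le_trans (le_of_eq ?_) hk
      rw [← ENNReal.ofReal_coe_nnreal, ← ENNReal.ofReal_coe_nnreal, hwk,
        ENNReal.ofReal_add hpos c.coe_nonneg]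
    · refine le_trans (le_of_eq ?_) h0
      rw [ENNReal.ofReal_of_nonpos hneg, zero_add, ← ENNReal.ofReal_coe_nnreal,
        ← ENNReal.ofReal_coe_nnreal, hw0]
      simp

end Dual

theorem exists_shift (a b : ℕ → ℝ) (K : ℕ) : ∃ (c : ℝ≥0) (u w : ℕ → ℝ≥0),
    (∀ k ≤ K, (u k : ℝ) = a k - a 0 + c) ∧ ∀ k ≤ K, (w k : ℝ) = b k - b 0 + c := by
  refine ⟨∑ k ∈ Finset.range (K + 1), (|a k - a 0| + |b k - b 0|).toNNReal,
    fun k => Real.toNNReal _, fun k => Real.toNNReal _, fun k hk => Real.coe_toNNReal _ ?_,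
    fun k hk => Real.coe_toNNReal _ ?_⟩
  all_goals
    have h := Finset.single_le_sum (f := fun k => (|a k - a 0| + |b k - b 0|).toNNReal)
      (fun _ _ => zero_le) (Finset.mem_range_succ_iff.2 hk)
    have h' : |a k - a 0| + |b k - b 0| ≤ _ := (Real.le_coe_toNNReal _).trans (NNReal.coe_le_coe.2 h)
    linarith [neg_abs_le (a k - a 0), neg_abs_le (b k - b 0), abs_nonneg (a k - a 0),
      abs_nonneg (b k - b 0)]

theorem exists_measurableEmbedding_cantor (Z : Type*) [MeasurableSpace Z] [TopologicalSpace Z]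
    [PolishSpace Z] [BorelSpace Z] :
    ∃ (U : ℕ → Set Z) (f : Z → ℕ → Bool), TopologicalSpace.IsTopologicalBasis (Set.range U) ∧
      MeasurableEmbedding f ∧ ∀ z i, f z i = true ↔ z ∈ U i := by
  classical
  obtain ⟨B, hBc, hBe, hB⟩ := TopologicalSpace.exists_countable_basis Z
  obtain ⟨U, hU⟩ : ∃ U : ℕ → Set Z, TopologicalSpace.IsTopologicalBasis (Set.range U) := by
    rcases B.eq_empty_or_nonempty with rfl | hne
    · refine ⟨fun _ => Set.univ, ?_⟩
      have : IsEmpty Z := by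
        rw [← Set.univ_eq_empty_iff, ← hB.sUnion_eq, Set.sUnion_empty]
      refine TopologicalSpace.isTopologicalBasis_of_isOpen_of_nhds ?_ fun z => isEmptyElim z
      rintro _ ⟨_, rfl⟩
      exact isOpen_univ
    · obtain ⟨U, rfl⟩ := hBc.exists_eq_range hne
      exact ⟨U, hB⟩
  have hopen : ∀ i, IsOpen (U i) := fun i => hU.isOpen (Set.mem_range_self i)
  have hf : Measurable fun z (i : ℕ) => decide (z ∈ U i) :=
    measurable_pi_lambda _ fun i => (measurable_to_bool (by
      convert (hopen i).measurableSet
      ext z; simp))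
  refine ⟨U, fun z i => decide (z ∈ U i), hU, hf.measurableEmbedding fun z z' h => ?_, by simp⟩
  refine hU.eq_iff.2 ?_
  rintro _ ⟨i, rfl⟩
  simpa using congrFun h i

/-- A closed relation between Polish spaces becomes a closed relation between Cantor spaces after a
suitable Borel encoding. -/
theorem exists_isClosed_preimage_cantor [TopologicalSpace X] [PolishSpace X] [BorelSpace X]
    [TopologicalSpace Y] [PolishSpace Y] [BorelSpace Y] {E : Set (X × Y)} (hE : IsClosed E) :
    ∃ (f : X → ℕ → Bool) (g : Y → ℕ → Bool) (F : Set ((ℕ → Bool) × (ℕ → Bool))),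
      MeasurableEmbedding f ∧ MeasurableEmbedding g ∧ IsClosed F ∧
        Prod.map f g ⁻¹' F = E := by
  obtain ⟨U, f, hU, hf, hfU⟩ := exists_measurableEmbedding_cantor X
  obtain ⟨V, g, hV, hg, hgV⟩ := exists_measurableEmbedding_cantor Y
  refine ⟨f, g, {p | ∀ i j, U i ×ˢ V j ⊆ Eᶜ → p.1 i = true → p.2 j = false}, hf, hg, ?_, ?_⟩
  · simp only [Set.ofPred_forall]
    refine isClosed_iInter fun i => isClosed_iInter fun j => isClosed_iInter fun _ => ?_
    have h1 : IsClopen {p : (ℕ → Bool) × (ℕ → Bool) | p.1 i = true} :=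
      (isClopen_discrete {true}).preimage (f := fun p : (ℕ → Bool) × (ℕ → Bool) => p.1 i)
        (by fun_prop)
    have h2 : IsClopen {p : (ℕ → Bool) × (ℕ → Bool) | p.2 j = false} :=
      (isClopen_discrete {false}).preimage (f := fun p : (ℕ → Bool) × (ℕ → Bool) => p.2 j)
        (by fun_prop)
    exact isClosed_imp h1.isOpen h2.isClosed
  · ext ⟨x, y⟩
    simp only [Set.mem_preimage, Prod.map_apply, Set.mem_ofPred_eq, hfU]
    constructor
    · intro h
      by_contra hxy
      obtain ⟨_, ⟨⟨_, ⟨i, rfl⟩, _, ⟨j, rfl⟩, rfl⟩, hmem, hsub⟩⟩ :=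
        (hU.prod hV).mem_nhds_iff.1 (hE.isOpen_compl.mem_nhds hxy)
      have := h i j hsub hmem.1
      rw [(hgV y j).2 hmem.2] at this
      exact absurd this (by simp)
    · intro hxy i j hsub hx
      by_contra hy
      exact hsub ⟨hx, (hgV y j).1 (by simpa using hy)⟩ hxy

theorem exists_continuous_measure_ne_le {C : Type*} [TopologicalSpace C] [CompactSpace C]
    [T2Space C] [TotallyDisconnectedSpace C] [SecondCountableTopology C] [MeasurableSpace C]
    [BorelSpace C] (μ : Measure C) [IsFiniteMeasure μ] {K : ℕ} {κ : C → ℕ} (hκ : Measurable κ)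
    (hκK : ∀ x, κ x ≤ K) {ε : ℝ} (hε : 0 < ε) :
    ∃ κ' : C → ℕ, Continuous κ' ∧ (∀ x, κ' x ≤ K) ∧ μ {x | κ' x ≠ κ x} ≤ ENNReal.ofReal ε := by
  classical
  have hdense : μ.MeasureDense {s : Set C | IsClopen s} := by
    refine Measure.MeasureDense.of_generateFrom_isSetAlgebra_finite μ
      ⟨isClopen_empty, fun s hs => IsClopen.compl hs, fun s t hs ht => IsClopen.union hs ht⟩ ?_
    rw [BorelSpace.measurable_eq (α := C)]
    exact isTopologicalBasis_isClopen.borel_eq_generateFrom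
  induction K generalizing κ ε with
  | zero =>
    refine ⟨fun _ => 0, continuous_const, fun _ => le_rfl, ?_⟩
    have : {x | (0 : ℕ) ≠ κ x} = ∅ := by
      ext x; simpa using (Nat.le_zero.1 (hκK x)).symm
    simp [this]
  | succ K ih =>
    obtain ⟨κ₁, hc, hle, hμ⟩ := ih (κ := fun x => min (κ x) K) (hκ.min measurable_const)
      (fun x => min_le_right _ _) (half_pos hε)
    obtain ⟨t, ht, hμt⟩ := hdense.approx {x | κ x = K + 1} (hκ (measurableSet_singleton _))
      (measure_ne_top _ _) _ (half_pos hε)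
    refine ⟨fun x => if x ∈ t then K + 1 else κ₁ x, ?_, fun x => ?_, ?_⟩
    · refine Continuous.if (fun x hx => ?_) continuous_const hc
      have : frontier t = ∅ := IsClopen.frontier_eq ht
      simp [this] at hx
    · dsimp only
      split_ifs
      · exact le_rfl
      · exact (hle x).trans K.le_succ
    · calc _ ≤ μ ({x | κ₁ x ≠ min (κ x) K} ∪ symmDiff {x | κ x = K + 1} t) := by
            refine measure_mono fun x hx => ?_
            by_contra hx'
            simp only [Set.mem_union, Set.mem_symmDiff, Set.mem_ofPred_eq, not_or, not_not] at hx' hx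
            have := hκK x
            by_cases hxt : x ∈ t
            · simp only [hxt, if_true] at hx
              have := hx'.2
              tauto
            · simp only [hxt, if_false] at hx
              have h2 : κ x ≠ K + 1 := by have := hx'.2; tauto
              refine hx ?_
              rw [hx'.1]; omega
        _ ≤ ENNReal.ofReal (ε / 2) + ENNReal.ofReal (ε / 2) :=
            (measure_union_le _ _).trans (add_le_add hμ hμt.le)
        _ = ENNReal.ofReal ε := by
            rw [← ENNReal.ofReal_add (half_pos hε).le (half_pos hε).le, add_halves]

theorem exists_forall_le_coe (u w : ℕ → ℝ≥0) (K : ℕ) : ∃ W : ℝ≥0, ∀ k ≤ K, u k ≤ W ∧ w k ≤ W := by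
  refine ⟨∑ k ∈ Finset.range (K + 1), (u k + w k), fun k hk => ?_⟩
  have h := Finset.single_le_sum (f := fun k => u k + w k)
    (fun _ _ => zero_le) (Finset.mem_range_succ_iff.2 hk)
  exact ⟨le_self_add.trans h, le_add_self.trans h⟩

theorem lintegral_coe_comp_le_add {C : Type*} [MeasurableSpace C] {P : Measure C}
    {u : ℕ → ℝ≥0} {W : ℝ≥0} {κ κ' : C → ℕ} (hu : ∀ x, u (κ x) ≤ W) (hκ : Measurable κ)
    (hκ' : Measurable κ') :
    ∫⁻ x, u (κ x) ∂P ≤ ∫⁻ x, u (κ' x) ∂P + W * P {x | κ' x ≠ κ x} := by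
  have hs : MeasurableSet {x | κ' x ≠ κ x} := (measurableSet_eq_fun hκ' hκ).compl
  have hu' : Measurable fun y => (u (κ' y) : ℝ≥0∞) :=
    (measurable_of_countable fun k => (u k : ℝ≥0∞)).comp hκ'
  rw [← lintegral_indicator_const hs, ← lintegral_add_left hu']
  refine lintegral_mono fun x => ?_
  by_cases hx : κ' x = κ x
  · simp [hx]
  · simp only [Set.indicator, Set.mem_ofPred_eq, ne_eq, hx, not_false_eq_true, if_true]
    exact (ENNReal.coe_le_coe.2 (hu x)).trans le_add_self

theorem dualValue_le_of_forall_continuous {C : Type*} [TopologicalSpace C] [CompactSpace C]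
    [T2Space C] [TotallyDisconnectedSpace C] [SecondCountableTopology C] [MeasurableSpace C]
    [BorelSpace C] {P Q : Measure C} [IsFiniteMeasure P] [IsFiniteMeasure Q] {u w : ℕ → ℝ≥0}
    {K : ℕ} {R : ℝ≥0∞}
    (h : ∀ κ : C → ℕ, Continuous κ → (∀ x, κ x ≤ K) → dualValue u w κ P Q ≤ R)
    {κ : C → ℕ} (hκ : Measurable κ) (hκK : ∀ x, κ x ≤ K) : dualValue u w κ P Q ≤ R := by
  obtain ⟨W, hW⟩ := exists_forall_le_coe u w K
  refine ENNReal.le_of_forall_pos_le_add fun ε hε _ => ?_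
  have hδ : (0 : ℝ) < ε / (W + 1) := by positivity
  obtain ⟨κ', hc, hκ'K, hμ⟩ := exists_continuous_measure_ne_le (P + Q) hκ hκK hδ
  calc dualValue u w κ P Q
      ≤ (∫⁻ x, u (κ' x) ∂Q + W * Q {x | κ' x ≠ κ x}) +
          (∫⁻ x, w (κ' x) ∂P + W * P {x | κ' x ≠ κ x}) :=
        add_le_add
          (lintegral_coe_comp_le_add (fun x => (hW _ (hκK x)).1) hκ hc.measurable)
          (lintegral_coe_comp_le_add (fun x => (hW _ (hκK x)).2) hκ hc.measurable)
    _ = dualValue u w κ' P Q + W * (P + Q) {x | κ' x ≠ κ x} := by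
        rw [dualValue, Measure.add_apply]; ring
    _ ≤ R + W * ENNReal.ofReal (ε / (W + 1)) := by gcongr; exact h κ' hc hκ'K
    _ ≤ R + ε := by
        gcongr
        rw [← ENNReal.ofReal_coe_nnreal (p := W), ← ENNReal.ofReal_mul W.coe_nonneg,
          ← ENNReal.ofReal_coe_nnreal (p := ε)]
        refine ENNReal.ofReal_le_ofReal ?_
        rw [mul_div_assoc', div_le_iff₀ (by positivity)]
        nlinarith [W.coe_nonneg, ε.coe_nonneg]

/-- Compactness of the measures of a given mass on a compact metrizable space. -/
theorem exists_limit_lintegral {Z : Type*} [TopologicalSpace Z] [CompactSpace Z]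
    [TopologicalSpace.MetrizableSpace Z] [MeasurableSpace Z] [BorelSpace Z] {M : ℝ≥0} (hM : M ≠ 0)
    {μ : ℕ → Measure Z} (hμ : ∀ n, μ n Set.univ = M) (U : Ultrafilter ℕ) :
    ∃ m : Measure Z, IsFiniteMeasure m ∧
      (∀ F : Set Z, IsClosed F → (∀ n, μ n Fᶜ = 0) → m Fᶜ = 0) ∧
      ∀ φ : Z → ℝ≥0, Continuous φ →
        Tendsto (fun n => ∫⁻ z, φ z ∂(μ n)) U (nhds (∫⁻ z, φ z ∂m)) := by
  have hM' : (M : ℝ≥0∞) ≠ 0 := by simpa using hM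
  let p : ℕ → ProbabilityMeasure Z := fun n => ⟨(M : ℝ≥0∞)⁻¹ • μ n, ⟨by
    simp [hμ, ENNReal.inv_mul_cancel hM' ENNReal.coe_ne_top]⟩⟩
  have hpμ : ∀ n, μ n = (M : ℝ≥0∞) • (p n : Measure Z) := fun n => by
    change _ = (M : ℝ≥0∞) • ((M : ℝ≥0∞)⁻¹ • μ n)
    rw [smul_smul, ENNReal.mul_inv_cancel hM' ENNReal.coe_ne_top, one_smul]
  obtain ⟨q, -, hq⟩ := isCompact_univ.ultrafilter_le_nhds (U.map p) (by simp)
  have hq : Tendsto p U (nhds q) := hq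
  refine ⟨(M : ℝ≥0∞) • (q : Measure Z), inferInstanceAs (IsFiniteMeasure (M • (q : Measure Z))),
    fun F hF h0 => ?_, fun φ hφ => ?_⟩
  · have h := ProbabilityMeasure.le_liminf_measure_open_of_tendsto hq hF.isOpen_compl
    have hp0 : ∀ n, (p n : Measure Z) Fᶜ = 0 := fun n => by
      change ((M : ℝ≥0∞)⁻¹ • μ n) Fᶜ = 0
      simp [h0]
    simp only [hp0, liminf_const, nonpos_iff_eq_zero] at h
    simp [h]
  · have h := (ProbabilityMeasure.tendsto_iff_forall_lintegral_tendsto.1 hq)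
      (BoundedContinuousFunction.mkOfCompact ⟨φ, hφ⟩)
    simp only [hpμ, lintegral_smul_measure]
    exact ENNReal.Tendsto.const_mul h (Or.inr ENNReal.coe_ne_top)

theorem map_eq_of_tendsto_lintegral {Z C : Type*} [TopologicalSpace Z] [MeasurableSpace Z]
    [BorelSpace Z] [TopologicalSpace C] [MeasurableSpace C] [BorelSpace C] [HasOuterApproxClosed C]
    {μ : ℕ → Measure Z} {m : Measure Z} [IsFiniteMeasure m] {U : Ultrafilter ℕ}
    (hm : ∀ φ : Z → ℝ≥0, Continuous φ →
      Tendsto (fun n => ∫⁻ z, φ z ∂(μ n)) U (nhds (∫⁻ z, φ z ∂m)))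
    {p : Z → C} (hp : Continuous p) {α : Measure C} (hα : ∀ n, (μ n).map p = α) :
    m.map p = α := by
  refine ext_of_forall_lintegral_eq_of_IsFiniteMeasure fun φ => ?_
  have hφ : Measurable fun z => (φ z : ℝ≥0∞) := by fun_prop
  have h := hm (φ ∘ p) (φ.continuous.comp hp)
  have hn : ∀ n, ∫⁻ z, ((φ ∘ p) z : ℝ≥0∞) ∂(μ n) = ∫⁻ z, φ z ∂α := fun n => by
    rw [← hα n, lintegral_map hφ hp.measurable]
    rfl
  simp only [hn] at h
  rw [lintegral_map hφ hp.measurable]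
  exact tendsto_nhds_unique h tendsto_const_nhds

/-- Pulling a limit plan back along Borel encodings: the mass that escapes from the range of the
encoding of `Y` is sent back along the measurable selection `h`. -/
theorem exists_mem_plans_of_encoding {C D : Type*} [MeasurableSpace C] [MeasurableSpace D]
    {f : X → C} {g : Y → D} (hf : MeasurableEmbedding f) (hg : MeasurableEmbedding g)
    {E : Set (X × Y)} (hE : MeasurableSet E) {F : Set (C × D)} (hF : Prod.map f g ⁻¹' F = E)
    {νX : Measure X} [IsFiniteMeasure νX] {h : X → Y} (hh : Measurable h)
    (hhE : ∀ᵐ x ∂νX, (x, h x) ∈ E) {m : Measure (C × D)} (hmF : m Fᶜ = 0)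
    (hm : m.map Prod.fst = νX.map f) :
    ∃ π ∈ Plans E νX, ∀ ψ : D → ℝ≥0∞, Measurable ψ →
      (∀ d ∉ Set.range g, ∀ y, ψ (g y) ≤ ψ d) →
        ∫⁻ y, ψ (g y) ∂(π.map Prod.snd) ≤ ∫⁻ d, ψ d ∂(m.map Prod.snd) := by
  have hΦ : MeasurableEmbedding (Prod.map f g) := hf.prodMap hg
  set B : Set (C × D) := Prod.snd ⁻¹' (Set.range g)ᶜ with hB
  have hBm : MeasurableSet B := measurable_snd hg.measurableSet_range.compl
  set e : Measure X := ((m.restrict B).map Prod.fst).comap f with he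
  set π' : Measure (X × Y) := m.comap (Prod.map f g) with hπ'
  have hgraph : Measurable fun x => (x, h x) := measurable_id.prodMk hh
  have he_apply : ∀ A, MeasurableSet A → e A = m (Prod.fst ⁻¹' (f '' A) ∩ B) := fun A hA => by
    have hfA := hf.measurableSet_image.2 hA
    rw [he, hf.comap_apply, Measure.map_apply measurable_fst hfA,
      Measure.restrict_apply (measurable_fst hfA)]
  have hsum : π'.map Prod.fst + e = νX := by
    ext A hA
    have hfA := hf.measurableSet_image.2 hA
    have himg : Prod.map f g '' (Prod.fst ⁻¹' A) = Prod.fst ⁻¹' (f '' A) \ B := by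
      ext ⟨c, d⟩
      simp only [Set.mem_image, Set.mem_preimage, Prod.exists, Prod.map_apply, Prod.mk.injEq,
        Set.mem_sdiff, hB, Set.mem_compl_iff, not_not, Set.mem_range]
      constructor
      · rintro ⟨x, y, hx, rfl, rfl⟩
        exact ⟨⟨x, hx, rfl⟩, y, rfl⟩
      · rintro ⟨⟨x, hx, rfl⟩, y, rfl⟩
        exact ⟨x, y, hx, rfl, rfl⟩
    rw [Measure.add_apply, Measure.map_apply measurable_fst hA, he_apply A hA, hπ',
      hΦ.comap_apply, himg, measure_sdiff_add_inter _ hBm, ← Measure.map_apply measurable_fst hfA,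
      hm, hf.map_apply, hf.injective.preimage_image]
  have heX : e ≤ νX := hsum ▸ Measure.le_add_left le_rfl
  have hfst : (π' + e.map fun x => (x, h x)).map Prod.fst = νX := by
    rw [Measure.map_add _ _ measurable_fst, Measure.map_map measurable_fst hgraph]
    change _ + e.map id = νX
    rw [Measure.map_id, hsum]
  refine ⟨π' + e.map (fun x => (x, h x)), ⟨⟨?_⟩, ?_, hfst⟩, fun ψ hψ hψB => ?_⟩
  · have := congrArg (fun ν => ν Set.univ) hfst
    simp only [Measure.map_apply measurable_fst MeasurableSet.univ, Set.preimage_univ] at this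
    rw [this]
    exact measure_lt_top _ _
  · rw [Measure.add_apply, add_eq_zero]
    constructor
    · rw [hπ', hΦ.comap_apply]
      refine measure_mono_null ?_ hmF
      rintro _ ⟨p, hp, rfl⟩ hpF
      exact hp (hF ▸ hpF)
    · rw [Measure.map_apply hgraph hE.compl]
      exact (Measure.absolutelyContinuous_of_le heX) hhE
  · have hψg : Measurable fun y => ψ (g y) := hψ.comp hg.measurable
    rw [Measure.map_add _ _ measurable_snd, lintegral_add_measure,
      lintegral_map hψ measurable_snd, Measure.map_map measurable_snd hgraph,
      lintegral_map hψg measurable_snd, lintegral_map hψg (measurable_snd.comp hgraph)]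
    have h1 : ∫⁻ p, ψ (g p.2) ∂π' ≤ ∫⁻ q in Bᶜ, ψ q.2 ∂m := by
      have : ∫⁻ p, ψ (g p.2) ∂π' = ∫⁻ q, ψ q.2 ∂(π'.map (Prod.map f g)) := by
        rw [hΦ.lintegral_map]; rfl
      rw [this, hπ', hΦ.map_comap]
      refine lintegral_mono_set ?_
      rintro _ ⟨p, rfl⟩ hp
      exact hp ⟨p.2, rfl⟩
    have h2 : ∫⁻ x, ψ (g (h x)) ∂e ≤ ∫⁻ q in B, ψ q.2 ∂m := by
      calc ∫⁻ x, ψ (g (h x)) ∂e ≤ ∫⁻ _, (⨆ y, ψ (g y)) ∂e :=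
            lintegral_mono fun x => le_iSup (fun y => ψ (g y)) (h x)
        _ = (⨆ y, ψ (g y)) * e Set.univ := lintegral_const _
        _ ≤ (⨆ y, ψ (g y)) * m B := by
            rw [he_apply _ MeasurableSet.univ]
            gcongr
            exact Set.inter_subset_right
        _ = ∫⁻ _ in B, (⨆ y, ψ (g y)) ∂m := (setLIntegral_const _ _).symm
        _ ≤ _ := setLIntegral_mono (hψ.comp measurable_snd) fun q hq =>
            iSup_le fun y => hψB q.2 hq y
    calc _ ≤ ∫⁻ q in Bᶜ, ψ q.2 ∂m + ∫⁻ q in B, ψ q.2 ∂m := add_le_add h1 h2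
      _ = ∫⁻ q, ψ q.2 ∂m := by rw [add_comm, lintegral_add_compl _ hBm]

theorem measure_map_snd_univ_of_mem_plans {E : Set (X × Y)} {νX : Measure X} {π : Measure (X × Y)}
    (hπ : π ∈ Plans E νX) : π.map Prod.snd Set.univ = νX Set.univ := by
  rw [← hπ.2.2, Measure.map_apply measurable_snd MeasurableSet.univ,
    Measure.map_apply measurable_fst MeasurableSet.univ, Set.preimage_univ, Set.preimage_univ]

theorem exists_mem_plans_shiftedDiv_le
    [TopologicalSpace X] [PolishSpace X] [BorelSpace X]
    [TopologicalSpace Y] [PolishSpace Y] [BorelSpace Y]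
    {E : Set (X × Y)} (hE : IsClosed E) (hN : ∀ x, ∃ y, (x, y) ∈ E)
    {νX : Measure X} {νY : Measure Y} [IsFiniteMeasure νX] [IsFiniteMeasure νY]
    (hνX : 0 < νX Set.univ) (a b : ℕ → ℝ) :
    ∃ πs ∈ Plans E νX, ∀ π ∈ Plans E νX,
      shiftedDiv a b (πs.map Prod.snd) νY ≤ shiftedDiv a b (π.map Prod.snd) νY := by
  have : Nonempty X := by
    by_contra hX
    rw [not_nonempty_iff] at hX
    simp [Measure.eq_zero_of_isEmpty νX] at hνX
  obtain ⟨h, hh, hhE⟩ := exists_measurable_ae_mem_of_isClosed hE hN νX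
  set S : Set ℝ≥0∞ := (fun π => shiftedDiv a b (π.map Prod.snd) νY) '' Plans E νX with hS
  have hgraph : Measurable fun x => (x, h x) := measurable_id.prodMk hh
  have hSne : S.Nonempty := by
    refine ⟨_, νX.map fun x => (x, h x), ⟨inferInstance, ?_, ?_⟩, rfl⟩
    · rw [Measure.map_apply hgraph hE.measurableSet.compl]
      exact hhE
    · rw [Measure.map_map measurable_fst hgraph]
      exact Measure.map_id
  obtain ⟨v, -, hv, hvS⟩ := exists_seq_tendsto_sInf hSne (OrderBot.bddBelow S)
  choose π hπ hπv using hvS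
  obtain ⟨f, g, F, hf, hg, hF, hFE⟩ := exists_isClosed_preimage_cantor hE
  have hΦ : Measurable (Prod.map f g) := hf.measurable.prodMap hg.measurable
  set μ : ℕ → Measure ((ℕ → Bool) × (ℕ → Bool)) := fun n => (π n).map (Prod.map f g) with hμ
  have hμM : ∀ n, μ n Set.univ = (νX Set.univ).toNNReal := fun n => by
    rw [ENNReal.coe_toNNReal (measure_ne_top _ _), hμ, Measure.map_apply hΦ MeasurableSet.univ,
      Set.preimage_univ, ← measure_map_snd_univ_of_mem_plans (hπ n),
      Measure.map_apply measurable_snd MeasurableSet.univ, Set.preimage_univ]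
  let U : Ultrafilter ℕ := Ultrafilter.of atTop
  have hU : Tendsto v U (nhds (sInf S)) := hv.mono_left (Ultrafilter.of_le _)
  obtain ⟨m, hmfin, hmF, hm⟩ := exists_limit_lintegral
    (ENNReal.toNNReal_ne_zero.2 ⟨hνX.ne', measure_ne_top _ _⟩) hμM U
  have hmfst : m.map Prod.fst = νX.map f := by
    refine map_eq_of_tendsto_lintegral hm continuous_fst fun n => ?_
    rw [hμ, Measure.map_map measurable_fst hΦ, ← (hπ n).2.2,
      Measure.map_map hf.measurable measurable_fst]
    rfl
  have hmF0 : m Fᶜ = 0 := by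
    refine hmF F hF fun n => ?_
    rw [hμ, Measure.map_apply hΦ hF.measurableSet.compl, Set.preimage_compl, hFE]
    exact (hπ n).2.1
  obtain ⟨πs, hπs, hπsψ⟩ := exists_mem_plans_of_encoding hf hg hE.measurableSet hFE hh hhE hmF0
    hmfst
  refine ⟨πs, hπs, fun π₀ hπ₀ => ?_⟩
  suffices hle : shiftedDiv a b (πs.map Prod.snd) νY ≤ sInf S from
    hle.trans (sInf_le ⟨π₀, hπ₀, rfl⟩)
  have hfin : IsFiniteMeasure πs := hπs.1
  have hfin' : ∀ n, IsFiniteMeasure (π n) := fun n => (hπ n).1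
  rw [shiftedDiv_eq_iSup_min]
  refine iSup_le fun K => ?_
  obtain ⟨c, u, w, hu, hw⟩ := exists_shift a b K
  obtain ⟨κ, hκ, hκK, hκle⟩ := exists_le_dualValue (P := πs.map Prod.snd) (Q := νY) hu hw
  rw [measure_map_snd_univ_of_mem_plans hπs] at hκle
  obtain ⟨k₀, hk₀, hk₀max⟩ := (Finset.range (K + 1)).exists_max_image w ⟨0, by simp⟩
  set κ' : (ℕ → Bool) → ℕ := Function.extend g κ fun _ => k₀ with hκ'
  have hκ'm : Measurable κ' := hg.measurable_extend hκ measurable_const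
  have hκ'g : ∀ y, κ' (g y) = κ y := fun y => hg.injective.extend_apply _ _ _
  have hκ'k₀ : ∀ d ∉ Set.range g, κ' d = k₀ := fun d hd => Function.extend_apply' _ _ _ hd
  have hκ'K : ∀ d, κ' d ≤ K := fun d => by
    by_cases hd : d ∈ Set.range g
    · obtain ⟨y, rfl⟩ := hd
      rw [hκ'g]
      exact hκK y
    · rw [hκ'k₀ d hd]
      exact Finset.mem_range_succ_iff.1 hk₀
  have hcoe : ∀ (s : ℕ → ℝ≥0) {κ : (ℕ → Bool) → ℕ}, Measurable κ →
      Measurable fun d => (s (κ d) : ℝ≥0∞) := fun s κ hκ =>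
    (measurable_of_countable fun k => (s k : ℝ≥0∞)).comp hκ
  have hdual : dualValue u w κ (πs.map Prod.snd) νY ≤
      dualValue u w κ' (m.map Prod.snd) (νY.map g) := by
    refine add_le_add (le_of_eq ?_) ?_
    · rw [lintegral_map (hcoe u hκ'm) hg.measurable]
      simp only [hκ'g]
    · have := hπsψ (fun d => w (κ' d)) (hcoe w hκ'm) fun d hd y => by
        rw [hκ'g, hκ'k₀ d hd]
        exact ENNReal.coe_le_coe.2 (hk₀max _ (Finset.mem_range_succ_iff.2 (hκK y)))
      simpa only [hκ'g] using this
  have hlim : dualValue u w κ' (m.map Prod.snd) (νY.map g) ≤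
      sInf S + c * (νY Set.univ + νX Set.univ) := by
    refine dualValue_le_of_forall_continuous (fun η hη hηK => ?_) hκ'm hκ'K
    have hwη : Continuous fun q : (ℕ → Bool) × (ℕ → Bool) => w (η q.2) :=
      continuous_of_discreteTopology.comp (hη.comp continuous_snd)
    have hlhs := (hm _ hwη).const_add (∫⁻ d, u (η d) ∂(νY.map g))
    have hrhs := hU.add_const (c * (νY Set.univ + νX Set.univ) : ℝ≥0∞)
    rw [dualValue, lintegral_map (hcoe w hη.measurable) measurable_snd]
    refine le_of_tendsto_of_tendsto' hlhs hrhs fun n => ?_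
    have hn := dualValue_le (P := (π n).map Prod.snd) (Q := νY) hu hw
      (hη.measurable.comp hg.measurable) fun y => hηK (g y)
    rw [measure_map_snd_univ_of_mem_plans (hπ n),
      show shiftedDiv a b ((π n).map Prod.snd) νY = v n from hπv n] at hn
    refine le_trans (le_of_eq ?_) hn
    have hwη' : Measurable fun q : (ℕ → Bool) × (ℕ → Bool) => (w (η q.2) : ℝ≥0∞) :=
      (hcoe w hη.measurable).comp measurable_snd
    rw [dualValue, hμ, lintegral_map (hcoe u hη.measurable) hg.measurable,
      lintegral_map hwη' hΦ,
      lintegral_map (show Measurable fun y => (w ((η ∘ g) y) : ℝ≥0∞) from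
        (hcoe w hη.measurable).comp hg.measurable) measurable_snd]
    rfl
  exact (ENNReal.add_le_add_iff_right (ENNReal.mul_ne_top ENNReal.coe_ne_top
    (ENNReal.add_ne_top.2 ⟨measure_ne_top _ _, measure_ne_top _ _⟩))).1
      (hκle.trans (hdual.trans hlim))

theorem vartheta_one_sided_attainment
    [TopologicalSpace X] [PolishSpace X] [BorelSpace X]
    [TopologicalSpace Y] [PolishSpace Y] [BorelSpace Y]
    (E : Set (X × Y)) (hE : IsClosed E)
    (νX : Measure X) (νY : Measure Y) [IsFiniteMeasure νX] [IsFiniteMeasure νY]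
    (hνX : 0 < νX Set.univ) (hνY : 0 < νY Set.univ)
    (hNbhdX : ∀ x : X, ∃ y : Y, (x, y) ∈ E) (hNbhdY : ∀ y : Y, ∃ x : X, (x, y) ∈ E)
    (θ : ℝ → EReal) (hθ : ProperConvexLSCOn θ) :
    ∃ πs ∈ Plans E νX,
      thetaDiv θ (πs.map Prod.snd) νY
        = sInf {d : EReal | ∃ π ∈ Plans E νX, d = thetaDiv θ (π.map Prod.snd) νY} := by
  obtain ⟨a, b, -, hab⟩ := hθ.exists_affine_seq
  obtain ⟨πs, hπs, hmin⟩ := exists_mem_plans_shiftedDiv_le (νY := νY) hE hNbhdX hνX a b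
  have hdiv : ∀ π ∈ Plans E νX, thetaDiv θ (π.map Prod.snd) νY =
      ((shiftedDiv a b (π.map Prod.snd) νY : ℝ≥0∞) : EReal) +
        ((a 0 * νY.real Set.univ + b 0 * νX.real Set.univ : ℝ) : EReal) := fun π hπ => by
    have := hπ.1
    rw [thetaDiv_eq_shiftedDiv_add hab (hθ.recessionSlope_eq hab), Measure.real, Measure.real,
      measure_map_snd_univ_of_mem_plans hπ]
    rfl
  refine ⟨πs, hπs, le_antisymm (le_sInf ?_) (sInf_le ⟨πs, hπs, rfl⟩)⟩
  rintro _ ⟨π, hπ, rfl⟩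
  rw [hdiv π hπ, hdiv πs hπs]
  gcongr
  exact EReal.coe_ennreal_le_coe_ennreal_iff.2 (hmin π hπ)
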